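/- arXiv:1603.01412 — 5 statements merged into one kernel-verified Lean document; each statement's English description precedes it below -/
import Mathlib

section
/- (Semantic content of Lemma 1, forward simulation.) Let 𝒜 = (initA, stepA) be an action system over state type α with observation obsA : α → O, and 𝒞 = (initC, stepC) an action system over state type γ with observation obsC : γ → O. Suppose there exist a relation R : α → γ → Prop and a variant function V : γ → ℕ such that: (1) for every τ ∈ initC there exists σ ∈ initA with R σ τ; (2) whenever R σ τ, obsA σ = obsC τ; (3) whenever R σ τ and stepC τ τ', there exist n ∈ ℕ and a chain σ = σ₀, σ₁, …, σₙ with stepA σᵢ σᵢ₊₁ for all i < n and R σₙ τ', such that the sequence of observations obsA σ₀, …, obsA σₙ changes value at most once (it consists of some copies of obsA σ₀ followed by copies of obsA σₙ), and moreover if n = 0 then V τ' < V τ; (4) whenever R σ τ and τ is not enabled in 𝒞, then σ is not enabled in 𝒜. Then 𝒜 ⊑ 𝒞. -/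
/-- An action system over a state type `σ`: a set of initial states and a step relation. -/
structure ActionSystem (σ : Type) where
  init : Set σ
  step : σ → σ → Prop

/-- A state is enabled if some step is possible from it. -/
def ActionSystem.Enabled {σ : Type} (A : ActionSystem σ) (x : σ) : Prop :=
  ∃ y, A.step x y

/-- A (finite or infinite) trace. -/
inductive Trace (σ : Type) where
  | fin : List σ → Trace σ
  | inf : (ℕ → σ) → Trace σ

/-- Complete traces: finite nonempty runs ending in a non-enabled state, or infinite runs. -/
def IsCompleteTrace {σ : Type} (A : ActionSystem σ) : Trace σ → Prop
  | .fin l => ∃ hl : l ≠ [], l.head hl ∈ A.init ∧ l.Chain' A.step ∧ ¬ A.Enabled (l.getLast hl)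
  | .inf s => s 0 ∈ A.init ∧ ∀ i, A.step (s i) (s (i + 1))

/-- Remove finite stuttering from a list (delete elements equal to their predecessor). -/
noncomputable def destutter {O : Type} (l : List O) : List O :=
  @List.destutter O (· ≠ ·) (fun _ _ => Classical.dec _) l

/-- Observable traces: a terminating finite trace, a finite trace ending in the
divergence symbol `↑`, or an infinite (stutter-free) trace. -/
inductive ObsTrace (O : Type) where
  | fin : List O → ObsTrace O
  | div : List O → ObsTrace O
  | inf : (ℕ → O) → ObsTrace O

/-- `TrOf obs s ot` holds iff `ot` is the observable trace `Tr(s)` of the complete trace `s`: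
finite stuttering is removed, and infinite stuttering is replaced by the divergence symbol. -/
def TrOf {σ O : Type} (obs : σ → O) : Trace σ → ObsTrace O → Prop
  | .fin l, ot => ot = .fin (destutter (l.map obs))
  | .inf s, ot =>
      (∃ k, (∀ i, k ≤ i → obs (s i) = obs (s k)) ∧
        (∀ k', k' < k → ¬ (∀ i, k' ≤ i → obs (s i) = obs (s k'))) ∧
        ot = .div (destutter ((List.range (k + 1)).map fun i => obs (s i))))
      ∨ ((¬ ∃ k, ∀ i, k ≤ i → obs (s i) = obs (s k)) ∧
        ∃ φ : ℕ → ℕ, StrictMono φ ∧ φ 0 = 0 ∧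
          (∀ i j, φ i ≤ j → j < φ (i + 1) → obs (s j) = obs (s (φ i))) ∧
          (∀ i, obs (s (φ (i + 1))) ≠ obs (s (φ i))) ∧
          ot = .inf fun i => obs (s (φ i)))

/-- Trace refinement `𝒜 ⊑ 𝒞`: every observable trace of a complete trace of `𝒞` is the
observable trace of some complete trace of `𝒜`. -/
def TraceRefines {α γ O : Type} (A : ActionSystem α) (obsA : α → O)
    (C : ActionSystem γ) (obsC : γ → O) : Prop :=
  ∀ s', IsCompleteTrace C s' → ∀ ot, TrOf obsC s' ot →
    ∃ s, IsCompleteTrace A s ∧ TrOf obsA s ot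

theorem destutter_cons_cons {O : Type} (a b : O) (l : List O) [Decidable (a = b)] :
    destutter (a :: b :: l) =
      if a = b then destutter (b :: l) else a :: destutter (b :: l) := by
  unfold destutter
  rw [List.destutter_cons_cons]
  by_cases h : a = b
  · subst h; simp [List.destutter]
  · simp [h, List.destutter]

theorem destutter_append_pair {O : Type} (l : List O) (a b : O) [Decidable (a = b)] :
    destutter (l ++ [a, b]) =
      if a = b then destutter (l ++ [a]) else destutter (l ++ [a]) ++ [b] := by
  classical
  induction l with
  | nil => by_cases h : a = b <;> simp [h, destutter]
  | cons x l ih =>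
    cases l with
    | nil =>
      simp only [List.nil_append, List.cons_append] at ih ⊢
      rw [destutter_cons_cons x a [b], ih, destutter_cons_cons x a []]
      split_ifs <;> simp
    | cons y l =>
      simp only [List.cons_append] at ih ⊢
      rw [destutter_cons_cons, ih, destutter_cons_cons]
      split_ifs <;> simp

/-- The destuttered prefix of `c` up to and including index `i`. -/
noncomputable def destutterPrefix {O : Type} (c : ℕ → O) (i : ℕ) : List O :=
  destutter ((List.range (i + 1)).map c)

theorem destutterPrefix_succ {O : Type} (c : ℕ → O) (i : ℕ) [Decidable (c i = c (i + 1))] :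
    destutterPrefix c (i + 1) =
      if c i = c (i + 1) then destutterPrefix c i else destutterPrefix c i ++ [c (i + 1)] := by
  unfold destutterPrefix
  have h := destutter_append_pair ((List.range i).map c) (c i) (c (i + 1))
  simpa [List.range_succ] using h

theorem destutterPrefix_eq_of_constant {O : Type} {c : ℕ → O} {i x : ℕ} (hix : i ≤ x)
    (h : ∀ y, i ≤ y → y ≤ x → c y = c i) : destutterPrefix c x = destutterPrefix c i := by
  classical
  induction x, hix using Nat.le_induction with
  | base => rfl
  | succ x hx ih =>
    rw [destutterPrefix_succ, if_pos, ih fun y h₁ h₂ => h y h₁ (by omega)]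
    rw [h x hx (by omega), h (x + 1) (by omega) le_rfl]

/-- `H` samples the sequence `c` without missing any change of value. -/
structure IsSampling {O : Type} (c : ℕ → O) (H : ℕ → ℕ) : Prop where
  zero : H 0 = 0
  mono : Monotone H
  unbounded : ∀ b, ∃ i, b ≤ H i
  const : ∀ i x, H i ≤ x → x < H (i + 1) → c x = c (H i)

namespace IsSampling

variable {O : Type} {c : ℕ → O} {H : ℕ → ℕ}

theorem exists_between (h : IsSampling c H) (x : ℕ) : ∃ i, H i ≤ x ∧ x < H (i + 1) := by
  classical
  have hx := h.unbounded (x + 1)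
  have hs := Nat.find_spec hx
  rcases hf : Nat.find hx with _ | i
  · rw [hf, h.zero] at hs; omega
  · have := Nat.find_min hx (m := i) (by omega)
    rw [hf] at hs
    exact ⟨i, by omega, by omega⟩

theorem exists_ne (h : IsSampling c H) {i x : ℕ} (hx : H i ≤ x) (hne : c x ≠ c (H i)) :
    ∃ y, i ≤ y ∧ c (H y) ≠ c (H i) := by
  obtain ⟨y, hy₁, hy₂⟩ := h.exists_between x
  refine ⟨y, ?_, h.const y x hy₁ hy₂ ▸ hne⟩
  by_contra hlt
  have := h.mono (show y + 1 ≤ i by omega)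
  omega

theorem exists_first (h : IsSampling c H) {x : ℕ} (hx : ∀ y, y + 1 = x → c y ≠ c x) :
    ∃ i, H i = x ∧ ∀ i' < i, H i' < x := by
  classical
  have hex := h.unbounded x
  have hs := Nat.find_spec hex
  refine ⟨Nat.find hex, ?_, fun i' hi' => not_le.1 (Nat.find_min hex hi')⟩
  rcases hf : Nat.find hex with _ | i
  · rw [hf, h.zero] at hs; rw [h.zero]; omega
  · have hi := Nat.find_min hex (m := i) (by omega)
    rw [hf] at hs
    by_contra hne
    exact hx (x - 1) (by omega)
      ((h.const i _ (by omega) (by omega)).trans (h.const i _ (by omega) (by omega)).symm)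

theorem destutterPrefix_eq (h : IsSampling c H) (i : ℕ) :
    destutterPrefix (fun j => c (H j)) i = destutterPrefix c (H i) := by
  classical
  induction i with
  | zero => simp [h.zero, destutterPrefix]
  | succ i ih =>
    rw [destutterPrefix_succ]
    simp only [ih]
    rcases (h.mono (show i ≤ i + 1 by omega)).eq_or_lt with he | hlt
    · simp [← he]
    · obtain ⟨x, hx⟩ : ∃ x, H (i + 1) = x + 1 := ⟨H (i + 1) - 1, by omega⟩
      have hix : H i ≤ x := by omega
      rw [hx, destutterPrefix_succ, h.const i x hix (by omega),
        destutterPrefix_eq_of_constant hix fun y h₁ h₂ => h.const i y h₁ (by omega)]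

theorem trOf {σ τ : Type} {obs : σ → O} {obs' : τ → O} {s : ℕ → σ} {t : ℕ → τ}
    (h : IsSampling (fun i => obs (s i)) H) (ht : ∀ i, obs' (t i) = obs (s (H i)))
    {ot : ObsTrace O} (hot : TrOf obs (.inf s) ot) : TrOf obs' (.inf t) ot := by
  simp only [TrOf, ht] at hot ⊢
  rcases hot with ⟨k, hk, hmin, rfl⟩ | ⟨hnc, φ, hφ, hφ0, hconst, hne, rfl⟩
  · left
    obtain ⟨K, hK, hlt⟩ := h.exists_first (x := k) (by
      rintro y rfl he
      refine hmin y (by omega) fun i hi => ?_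
      rcases hi.eq_or_lt with rfl | hi
      · rfl
      · exact (hk i hi).trans he.symm)
    refine ⟨K, fun i hi => ?_, fun k' hk' hc => ?_, ?_⟩
    · rw [hK]; exact hk _ (hK ▸ h.mono hi)
    · refine hmin _ (hlt k' hk') fun x hx => ?_
      by_contra hne
      obtain ⟨y, hy, hyne⟩ := h.exists_ne hx hne
      exact hyne (hc y hy)
    · have := h.destutterPrefix_eq K
      rw [hK] at this
      exact congrArg _ this.symm
  · right
    refine ⟨?_, ?_⟩
    · rintro ⟨k, hk⟩
      refine hnc ⟨H k, fun x hx => ?_⟩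
      by_contra hne
      obtain ⟨y, hy, hyne⟩ := h.exists_ne hx hne
      exact hyne (hk y hy)
    · have hfirst : ∀ i, ∃ y, H y = φ i ∧ ∀ y' < y, H y' < φ i := by
        refine fun i => h.exists_first fun y hy he => ?_
        rcases i with _ | i
        · omega
        · have := hφ (Nat.lt_succ_self i)
          simp only [Nat.succ_eq_add_one] at this
          exact hne i (he.symm.trans (hconst i y (by omega) (by omega)))
      choose ψ hψ hψlt using hfirst
      refine ⟨ψ, ?_, ?_, fun i j h₁ h₂ => ?_, fun i => ?_, ?_⟩
      · intro i j hij
        have := hφ hij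
        rw [← hψ, ← hψ] at this
        exact h.mono.reflect_lt this
      · by_contra h0
        have := hψlt 0 0 (by omega)
        omega
      · rw [hψ]
        exact hconst i _ (hψ i ▸ h.mono h₁) (hψlt _ _ h₂)
      · rw [hψ, hψ]; exact hne i
      · simp only [hψ]

end IsSampling

/-- The simulation of one concrete step: the sequence `g 0, …, g n` is a run of `A` whose
observation starts at `o`, ends at `o'` and changes value at most once. -/
structure IsSimChain {α O : Type} (A : ActionSystem α) (obsA : α → O) (n : ℕ) (g : ℕ → α)
    (o o' : O) : Prop where
  step : ∀ i, i < n → A.step (g i) (g (i + 1))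
  obs_zero : obsA (g 0) = o
  obs : ∃ m, m ≤ n ∧ (∀ i, i < m → obsA (g i) = o) ∧ ∀ i, m ≤ i → i ≤ n → obsA (g i) = o'

namespace IsSimChain

variable {α O : Type} {A : ActionSystem α} {obsA : α → O} {g : ℕ → α} {o o' : O}

theorem eq_of_length_zero (h : IsSimChain A obsA 0 g o o') : o = o' := by
  obtain ⟨m, hm, -, h'⟩ := h.obs
  exact h.obs_zero.symm.trans (h' 0 hm le_rfl)

theorem tail {n : ℕ} (h : IsSimChain A obsA (n + 1) g o o') :
    IsSimChain A obsA n (fun i => g (i + 1)) o o' ∨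
      IsSimChain A obsA n (fun i => g (i + 1)) o' o' := by
  obtain ⟨m, hm, h₁, h₂⟩ := h.obs
  rcases le_or_gt m 1 with hm1 | hm1
  · exact .inr ⟨fun i hi => h.step _ (by omega), h₂ _ (by omega) (by omega), 0, by omega,
      fun i hi => by omega, fun i _ hi => h₂ _ (by omega) (by omega)⟩
  · exact .inl ⟨fun i hi => h.step _ (by omega), h₁ _ (by omega), m - 1, by omega,
      fun i hi => h₁ _ (by omega), fun i hi hi' => h₂ _ (by omega) (by omega)⟩

end IsSimChain

/-- From `σ` there is a run of `A` through the states of `σ :: l`, ending in a state that is not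
enabled, whose destuttered observations are `D`. -/
def HasTerminatingRun {α O : Type} (A : ActionSystem α) (obsA : α → O) (σ : α)
    (D : List O) : Prop :=
  ∃ l, List.IsChain A.step (σ :: l) ∧ ¬ A.Enabled ((σ :: l).getLast (List.cons_ne_nil _ _)) ∧
    destutter ((σ :: l).map obsA) = D

theorem IsSimChain.hasTerminatingRun {α O : Type} {A : ActionSystem α} {obsA : α → O}
    {n : ℕ} {g : ℕ → α} {o o' : O} (h : IsSimChain A obsA n g o o') {l : List O}
    (hl : HasTerminatingRun A obsA (g n) (destutter (o' :: l))) :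
    HasTerminatingRun A obsA (g 0) (destutter (o :: o' :: l)) := by
  classical
  induction n generalizing g o with
  | zero =>
    obtain rfl := h.eq_of_length_zero
    rwa [destutter_cons_cons, if_pos rfl]
  | succ n ih =>
    have hs := h.step 0 (by omega)
    have h0 := h.obs_zero
    rcases h.tail with ht | ht
    · obtain ⟨r, hr, he, hd⟩ := ih ht hl
      refine ⟨g 1 :: r, .cons_cons hs hr, by simpa using he, ?_⟩
      have h1 : obsA (g 1) = o := ht.obs_zero
      simp only [List.map_cons, zero_add] at hd ⊢
      rw [destutter_cons_cons, if_pos (h0.trans h1.symm), hd]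
    · obtain ⟨r, hr, he, hd⟩ := ih ht hl
      refine ⟨g 1 :: r, .cons_cons hs hr, by simpa using he, ?_⟩
      have h1 : obsA (g 1) = o' := ht.obs_zero
      simp only [List.map_cons, zero_add] at hd ⊢
      rw [destutter_cons_cons o' o', if_pos rfl] at hd
      rw [destutter_cons_cons, destutter_cons_cons, hd, h0, h1]

theorem exists_seq_of_step {β : Type} {P : β → Prop} {Q : β → β → Prop}
    (h : ∀ x, P x → ∃ y, P y ∧ Q x y) {x : β} (hx : P x) :
    ∃ f : ℕ → β, f 0 = x ∧ ∀ i, P (f i) ∧ Q (f i) (f (i + 1)) := by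
  choose! F hP hQ using h
  have hf : ∀ i, P (F^[i] x) := fun i => by
    induction i with
    | zero => exact hx
    | succ i ih => rw [Function.iterate_succ_apply']; exact hP _ ih
  refine ⟨fun i => F^[i] x, rfl, fun i => ⟨hf i, ?_⟩⟩
  simp only [Function.iterate_succ_apply']
  exact hQ _ (hf i)

theorem unbounded_of_lex_step {T n : ℕ → ℕ}
    (h : ∀ i, T i < T (i + 1) ∨ T i = T (i + 1) ∧ n (i + 1) < n i) (b : ℕ) :
    ∃ i, b ≤ T i := by
  have hlt : ∀ k i, n i = k → ∃ j, T i < T j := fun k => by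
    induction k using Nat.strong_induction_on with
    | _ k ih =>
      intro i hi
      rcases h i with h' | ⟨he, h'⟩
      · exact ⟨_, h'⟩
      · obtain ⟨j, hj⟩ := ih _ (hi ▸ h') (i + 1) rfl
        exact ⟨j, he ▸ hj⟩
  induction b with
  | zero => exact ⟨0, Nat.zero_le _⟩
  | succ b ih =>
    obtain ⟨i, hi⟩ := ih
    obtain ⟨j, hj⟩ := hlt _ i rfl
    exact ⟨j, by omega⟩

section Simulation

variable {α γ O : Type} {A : ActionSystem α} {obsA : α → O} {C : ActionSystem γ} {obsC : γ → O}
  {R : α → γ → Prop} {V : γ → ℕ}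

theorem hasTerminatingRun_of_simulation
    (hObs : ∀ σ τ, R σ τ → obsA σ = obsC τ)
    (hSim : ∀ σ τ τ', R σ τ → C.step τ τ' → ∃ n g, g 0 = σ ∧
      IsSimChain A obsA n g (obsC τ) (obsC τ') ∧ R (g n) τ' ∧ (n = 0 → V τ' < V τ))
    (hGrd : ∀ σ τ, R σ τ → ¬ C.Enabled τ → ¬ A.Enabled σ)
    {l : List γ} {σ : α} {τ : γ} (hR : R σ τ) (hl : List.IsChain C.step (τ :: l))
    (he : ¬ C.Enabled ((τ :: l).getLast (List.cons_ne_nil _ _))) :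
    HasTerminatingRun A obsA σ (destutter ((τ :: l).map obsC)) := by
  induction l generalizing σ τ with
  | nil => exact ⟨[], .singleton _, hGrd _ _ hR he, by simp [hObs _ _ hR]⟩
  | cons τ' l ih =>
    rw [List.isChain_cons_cons] at hl
    obtain ⟨n, g, rfl, hg, hR', -⟩ := hSim _ _ _ hR hl.1
    exact hg.hasTerminatingRun (ih hR' hl.2 (by simpa using he))

theorem exists_nonempty_chain
    (hObs : ∀ σ τ, R σ τ → obsA σ = obsC τ)
    (hSim : ∀ σ τ τ', R σ τ → C.step τ τ' → ∃ n g, g 0 = σ ∧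
      IsSimChain A obsA n g (obsC τ) (obsC τ') ∧ R (g n) τ' ∧ (n = 0 → V τ' < V τ))
    {s : ℕ → γ} (hs : ∀ i, C.step (s i) (s (i + 1))) {σ : α} {T : ℕ} (hR : R σ (s T)) :
    ∃ k n g, T ≤ k ∧ (∀ x, T ≤ x → x ≤ k → obsC (s x) = obsA σ) ∧ g 0 = σ ∧
      IsSimChain A obsA (n + 1) g (obsC (s k)) (obsC (s (k + 1))) ∧
      R (g (n + 1)) (s (k + 1)) := by
  induction hv : V (s T) using Nat.strong_induction_on generalizing T with
  | _ v ih =>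
    obtain ⟨n, g, hg0, hg, hR', hV⟩ := hSim _ _ _ hR (hs T)
    rcases n with _ | n
    · rw [hg0] at hR'
      obtain ⟨k, n, g', hk, hc, h⟩ := ih _ (hv ▸ hV rfl) hR' rfl
      refine ⟨k, n, g', by omega, fun x h₁ h₂ => ?_, h⟩
      rcases h₁.eq_or_lt with rfl | h₁
      · exact (hObs _ _ hR).symm
      · exact hc x h₁ h₂
    · refine ⟨T, n, g, le_rfl, fun x h₁ h₂ => ?_, hg0, hg, hR'⟩
      rw [le_antisymm h₂ h₁, hObs _ _ hR]

/-- A snapshot of the simulation of an infinite run: the current abstract state, the number of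
steps left in the current chain, the index whose observation is currently visible, and the index
reached at the end of the chain. -/
structure SimState (α : Type) where
  state : α
  left : ℕ
  cur : ℕ
  target : ℕ

/-- The invariant of a snapshot when simulating the run `s`. -/
def SimState.Valid (A : ActionSystem α) (obsA : α → O) (obsC : γ → O) (R : α → γ → Prop)
    (s : ℕ → γ) (x : SimState α) : Prop :=
  x.cur ≤ x.target ∧ x.target ≤ x.cur + 1 ∧ ∃ g, g 0 = x.state ∧
    IsSimChain A obsA x.left g (obsC (s x.cur)) (obsC (s x.target)) ∧ R (g x.left) (s x.target)

theorem SimState.Valid.exists_step {s : ℕ → γ} {x : SimState α}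
    (hx : x.Valid A obsA obsC R s) {n : ℕ} (hn : x.left = n + 1) :
    ∃ y : SimState α, y.Valid A obsA obsC R s ∧ A.step x.state y.state ∧ x.cur ≤ y.cur ∧
      (∀ z, x.cur ≤ z → z < y.cur → obsC (s z) = obsC (s x.cur)) ∧
      y.target = x.target ∧ y.left = n := by
  obtain ⟨σ, _, j, T⟩ := x
  obtain rfl : _ = n + 1 := hn
  obtain ⟨h₁, h₂, g, rfl, hg, hR⟩ := hx
  dsimp only at *
  have hs := hg.step 0 (by omega)
  rcases hg.tail with ht | ht
  · exact ⟨⟨g 1, n, j, T⟩, ⟨h₁, h₂, _, rfl, ht, hR⟩, hs, le_rfl, fun z _ _ => by grind, rfl, rfl⟩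
  · refine ⟨⟨g 1, n, T, T⟩, ⟨le_rfl, by simp, _, rfl, ht, hR⟩, hs, h₁, fun z hz hz' => ?_,
      rfl, rfl⟩
    dsimp only at hz'
    rw [show z = j by omega]

theorem SimState.Valid.exists_next
    (hObs : ∀ σ τ, R σ τ → obsA σ = obsC τ)
    (hSim : ∀ σ τ τ', R σ τ → C.step τ τ' → ∃ n g, g 0 = σ ∧
      IsSimChain A obsA n g (obsC τ) (obsC τ') ∧ R (g n) τ' ∧ (n = 0 → V τ' < V τ))
    {s : ℕ → γ} (hs : ∀ i, C.step (s i) (s (i + 1))) (x : SimState α)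
    (hx : x.Valid A obsA obsC R s) :
    ∃ y : SimState α, y.Valid A obsA obsC R s ∧ A.step x.state y.state ∧ x.cur ≤ y.cur ∧
      (∀ z, x.cur ≤ z → z < y.cur → obsC (s z) = obsC (s x.cur)) ∧
      (x.target < y.target ∨ x.target = y.target ∧ y.left < x.left) := by
  rcases hn : x.left with _ | n
  · obtain ⟨σ, _, j, T⟩ := x
    obtain rfl : _ = 0 := hn
    obtain ⟨h₁, h₂, g, rfl, hg, hR⟩ := hx
    dsimp only at *
    obtain ⟨k, n, g', hk, hc, hg0, hg', hR'⟩ := exists_nonempty_chain hObs hSim hs hR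
    have hj : ∀ z, j ≤ z → z ≤ k → obsC (s z) = obsC (s j) := fun z hz hzk => by
      rcases hz.eq_or_lt with rfl | hz
      · rfl
      · rw [hc z (by omega) hzk, hg.obs_zero]
    have hv : SimState.Valid A obsA obsC R s ⟨g 0, n + 1, k, k + 1⟩ :=
      ⟨by simp, le_rfl, g', hg0, hg', hR'⟩
    obtain ⟨y, hy, hst, hcur, hyc, hyT, -⟩ := hv.exists_step rfl
    dsimp only at *
    refine ⟨y, hy, hst, by omega, fun z hz hzy => ?_, .inl (by omega)⟩
    rcases le_or_gt z k with hzk | hzk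
    · exact hj z hz hzk
    · rw [hyc z hzk.le hzy, hj k (by omega) le_rfl]
  · obtain ⟨y, hy, hst, hcur, hyc, hyT, hyn⟩ := hx.exists_step hn
    exact ⟨y, hy, hst, hcur, hyc, .inr ⟨hyT.symm, by omega⟩⟩

end Simulation

/-- Forward simulation (Lemma 1) implies trace refinement. -/
theorem forward_simulation_implies_trace_refinement
    {α γ O : Type} (A : ActionSystem α) (obsA : α → O)
    (C : ActionSystem γ) (obsC : γ → O)
    (R : α → γ → Prop) (V : γ → ℕ)
    (hInit : ∀ τ ∈ C.init, ∃ σ ∈ A.init, R σ τ)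
    (hObs : ∀ σ τ, R σ τ → obsA σ = obsC τ)
    (hStep : ∀ σ τ τ', R σ τ → C.step τ τ' →
      ∃ (n : ℕ) (g : ℕ → α), g 0 = σ ∧
        (∀ i, i < n → A.step (g i) (g (i + 1))) ∧
        R (g n) τ' ∧
        (∃ m, m ≤ n ∧ (∀ i, i < m → obsA (g i) = obsA (g 0)) ∧
          (∀ i, m ≤ i → i ≤ n → obsA (g i) = obsA (g n))) ∧
        (n = 0 → V τ' < V τ))
    (hGrd : ∀ σ τ, R σ τ → ¬ C.Enabled τ → ¬ A.Enabled σ) :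
    TraceRefines A obsA C obsC := by
  have hSim : ∀ σ τ τ', R σ τ → C.step τ τ' → ∃ n g, g 0 = σ ∧
      IsSimChain A obsA n g (obsC τ) (obsC τ') ∧ R (g n) τ' ∧ (n = 0 → V τ' < V τ) := by
    intro σ τ τ' hR hst
    obtain ⟨n, g, rfl, hg, hR', ⟨m, hm, h₁, h₂⟩, hV⟩ := hStep σ τ τ' hR hst
    rw [hObs _ _ hR] at h₁
    rw [hObs _ _ hR'] at h₂
    exact ⟨n, g, rfl, ⟨hg, hObs _ _ hR, m, hm, h₁, h₂⟩, hR', hV⟩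
  rintro (l | s) hs ot hot
  · obtain ⟨hne, hi, hl, he⟩ := hs
    obtain ⟨τ, l, rfl⟩ := List.exists_cons_of_ne_nil hne
    obtain ⟨σ, hσ, hR⟩ := hInit τ hi
    obtain ⟨r, hr, hre, hd⟩ := hasTerminatingRun_of_simulation hObs hSim hGrd hR hl he
    exact ⟨.fin (σ :: r), ⟨List.cons_ne_nil _ _, hσ, hr, hre⟩,
      hot.trans (congrArg ObsTrace.fin hd.symm)⟩
  · obtain ⟨hi, hs⟩ := hs
    obtain ⟨σ, hσ, hR⟩ := hInit _ hi
    have hv : SimState.Valid A obsA obsC R s ⟨σ, 0, 0, 0⟩ :=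
      ⟨le_rfl, by simp, fun _ => σ, rfl, ⟨fun i hi => absurd hi (Nat.not_lt_zero i),
        hObs _ _ hR, 0, le_rfl, fun i hi => absurd hi (Nat.not_lt_zero i),
        fun _ _ _ => hObs _ _ hR⟩, hR⟩
    obtain ⟨f, hf0, hf⟩ :=
      exists_seq_of_step (SimState.Valid.exists_next hObs hSim hs) hv
    have hH : IsSampling (fun i => obsC (s i)) (fun i => (f i).cur) :=
      { zero := by simp [hf0]
        mono := monotone_nat_of_le_succ fun i => (hf i).2.2.1
        unbounded := fun b => by
          obtain ⟨i, hi⟩ := unbounded_of_lex_step (T := fun i => (f i).target)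
            (n := fun i => (f i).left) (fun i => (hf i).2.2.2.2) (b + 1)
          have := (hf i).1.2.1
          exact ⟨i, by omega⟩
        const := fun i => (hf i).2.2.2.1 }
    refine ⟨.inf fun i => (f i).state, ⟨by simpa [hf0] using hσ, fun i => (hf i).2.1⟩,
      hH.trOf (fun i => ?_) hot⟩
    obtain ⟨-, -, g, hg0, hg, -⟩ := (hf i).1
    exact hg0 ▸ hg.obs_zero
end

section
/- (Semantic content of Lemma 2, backward simulation.) Let 𝒜 = (initA, stepA) be an action system over state type α with observation obsA : α → O which is continuous, i.e., for every σ the set {σ' | stepA σ σ'} is finite, and let 𝒞 = (initC, stepC) be an action system over state type γ with observation obsC : γ → O. Suppose there exist a relation R : α → γ → Prop that is total (for every τ there exists σ with R σ τ) and image-finite (for every τ the set {σ | R σ τ} is finite), and a variant function V : γ → ℕ, such that: (1) whenever τ ∈ initC and R σ τ, then σ ∈ initA; (2) whenever R σ τ, obsA σ = obsC τ; (3) whenever stepC τ τ' and R σ' τ', there exist n ∈ ℕ and a chain σ₀, σ₁, …, σₙ = σ' with stepA σᵢ σᵢ₊₁ for all i < n and R σ₀ τ, such that the sequence of observations obsA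 σ₀, …, obsA σₙ changes value at most once (it consists of some copies of obsA σ₀ followed by copies of obsA σₙ), and moreover if n = 0 then V τ' < V τ; (4) whenever τ is not enabled in 𝒞, there exists σ with R σ τ and σ not enabled in 𝒜. Then 𝒜 ⊑ 𝒞. -/
/-- Destuttering a list extended by one element appends it unless it repeats the last element. -/
theorem destutter'_concat {O : Type} [DecidableRel (fun x y : O => x ≠ y)] (l : List O) (x : O) :
    ∀ a : O, ((l ++ [x]).destutter' (· ≠ ·) a = l.destutter' (· ≠ ·) a ∧
        (a :: l).getLast (by simp) = x) ∨
      ((l ++ [x]).destutter' (· ≠ ·) a = l.destutter' (· ≠ ·) a ++ [x] ∧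
        (a :: l).getLast (by simp) ≠ x) := by
  induction l with
  | nil =>
    intro a
    by_cases h : a = x <;> simp [List.destutter', h]
  | cons b l ih =>
    intro a
    by_cases h : a = b
    · subst h
      simpa [List.destutter'] using ih a
    · simpa [List.destutter', h] using ih b

/-- The destuttered initial segment `a 0, …, a n` of a sequence. -/
noncomputable def destutterUpTo {O : Type} (a : ℕ → O) (n : ℕ) : List O :=
  destutter ((List.range (n + 1)).map a)

theorem destutterUpTo_zero {O : Type} (a : ℕ → O) : destutterUpTo a 0 = [a 0] := by
  simp [destutterUpTo, destutter]

theorem destutterUpTo_succ {O : Type} (a : ℕ → O) (n : ℕ) :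
    (a n = a (n + 1) ∧ destutterUpTo a (n + 1) = destutterUpTo a n) ∨
      (a n ≠ a (n + 1) ∧ destutterUpTo a (n + 1) = destutterUpTo a n ++ [a (n + 1)]) := by
  let : DecidableRel (fun x y : O => x ≠ y) := fun _ _ => Classical.dec _
  have h := destutter'_concat ((List.range n).map fun i => a (i + 1)) (a (n + 1)) (a 0)
  have hcons : ∀ k, (List.range (k + 1)).map a =
      a 0 :: (List.range k).map fun i => a (i + 1) := by
    intro k
    rw [List.range_succ_eq_map]
    simp [Function.comp_def]
  have hlast : (a 0 :: (List.range n).map fun i => a (i + 1)).getLast (by simp) = a n := by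
    simp [← hcons]
  have hd : ∀ k, destutterUpTo a k =
      ((List.range k).map fun i => a (i + 1)).destutter' (· ≠ ·) (a 0) := by
    intro k
    rw [destutterUpTo, hcons]
    rfl
  have hc : ((List.range (n + 1)).map fun i => a (i + 1)) =
      ((List.range n).map fun i => a (i + 1)) ++ [a (n + 1)] := by
    rw [List.range_succ]; simp
  rw [hlast, ← hc, ← hd, ← hd] at h
  tauto

theorem destutterUpTo_eq_of_const {O : Type} {a : ℕ → O} {m n : ℕ} (hmn : m ≤ n)
    (h : ∀ j, m ≤ j → j ≤ n → a j = a m) : destutterUpTo a n = destutterUpTo a m := by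
  induction n, hmn using Nat.le_induction with
  | base => rfl
  | succ n hmn ih =>
    have h' : a n = a (n + 1) := (h n hmn (by omega)).trans (h (n + 1) (by omega) le_rfl).symm
    rcases destutterUpTo_succ a n with ⟨-, h2⟩ | ⟨h1, -⟩
    · rw [h2]; exact ih fun j hj hj' => h j hj (by omega)
    · exact absurd h' h1

/-- `b` runs through the values of `a` in order, reaching `a i` at time `q i` and keeping it
until time `q (i + 1)`; coinciding times are allowed only where `a` stutters. -/
structure Retimes {O : Type} (a b : ℕ → O) (q : ℕ → ℕ) : Prop where
  mono : Monotone q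
  zero : q 0 = 0
  apply_time : ∀ i, b (q i) = a i
  apply_of_lt : ∀ i j, q i ≤ j → j < q (i + 1) → b j = a i

namespace Retimes

variable {O : Type} {a b : ℕ → O} {q : ℕ → ℕ}

theorem destutterUpTo_eq (h : Retimes a b q) (i : ℕ) :
    destutterUpTo b (q i) = destutterUpTo a i := by
  induction i with
  | zero =>
    rw [h.zero, destutterUpTo_zero, destutterUpTo_zero, ← h.apply_time 0, h.zero]
  | succ i ih =>
    rcases (h.mono (Nat.le_succ i)).eq_or_lt with he | hlt
    · have haa : a i = a (i + 1) := by rw [← h.apply_time, ← h.apply_time, he]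
      rcases destutterUpTo_succ a i with ⟨-, h2⟩ | ⟨h1, -⟩
      · rw [h2, ← ih, he]
      · exact absurd haa h1
    · obtain ⟨r, hr⟩ : ∃ r, q (i + 1) = r + 1 := ⟨q (i + 1) - 1, by simp at hlt; omega⟩
      have hir : q i ≤ r := by simp at hlt; omega
      have hbr : b r = a i := h.apply_of_lt i r hir (by omega)
      have hD : destutterUpTo b r = destutterUpTo a i := by
        rw [← ih]
        refine destutterUpTo_eq_of_const hir fun j hj hj' => ?_
        rw [h.apply_of_lt i j hj (by omega), h.apply_time]
      have hbs : b (r + 1) = a (i + 1) := by rw [← hr, h.apply_time]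
      rw [hr]
      have h1 := destutterUpTo_succ b r
      have h2 := destutterUpTo_succ a i
      rw [hbr, hbs, hD] at h1
      rcases h1 with ⟨e1, d1⟩ | ⟨e1, d1⟩ <;> rcases h2 with ⟨e2, d2⟩ | ⟨e2, d2⟩
      · rw [d1, d2]
      · exact absurd e1 e2
      · exact absurd e2 e1
      · rw [d1, d2]

theorem exists_block (h : Retimes a b q) {m n j : ℕ} (hmn : m ≤ n) (hm : q m ≤ j)
    (hn : j < q n) : ∃ i, m ≤ i ∧ i < n ∧ b j = a i := by
  induction n, hmn using Nat.le_induction with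
  | base => omega
  | succ n hmn ih =>
    by_cases hj : j < q n
    · obtain ⟨i, h1, h2, h3⟩ := ih hj
      exact ⟨i, h1, by omega, h3⟩
    · exact ⟨n, hmn, by omega, h.apply_of_lt n j (by omega) hn⟩

theorem eventually_const_iff (h : Retimes a b q) (hq : ∀ B, ∃ i, B ≤ q i) (k : ℕ) :
    (∀ j, q k ≤ j → b j = b (q k)) ↔ ∀ i, k ≤ i → a i = a k := by
  constructor
  · intro hb i hi
    rw [← h.apply_time, hb _ (h.mono hi), h.apply_time]
  · intro ha j hj
    obtain ⟨n, hn⟩ := hq (j + 1)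
    have hkn : k ≤ n := by
      by_contra! hnk
      have := h.mono hnk.le
      omega
    obtain ⟨i, hi, -, he⟩ := h.exists_block hkn hj (by omega)
    rw [he, ha i hi, h.apply_time]

/-- Retiming preserves observable traces of infinite runs. -/
theorem trOf {α γ : Type} {obsA : α → O} {obsC : γ → O} {t : ℕ → α} {s : ℕ → γ}
    (h : Retimes (fun i => obsC (s i)) (fun j => obsA (t j)) q) (hq : ∀ B, ∃ i, B ≤ q i)
    {ot : ObsTrace O} (hot : TrOf obsC (.inf s) ot) : TrOf obsA (.inf t) ot := by
  rcases hot with ⟨k, hk, hmin, rfl⟩ | ⟨hnc, φ, hφ, hφ0, hconst, hne, rfl⟩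
  · refine Or.inl ⟨q k, (h.eventually_const_iff hq k).2 hk, fun k' hk' hc => ?_,
      congrArg ObsTrace.div (h.destutterUpTo_eq k).symm⟩
    obtain ⟨i, -, hi, he⟩ := h.exists_block (m := 0) (Nat.zero_le k)
      (by rw [h.zero]; exact Nat.zero_le _) hk'
    have hik : obsC (s i) = obsC (s k) := by
      have h1 := h.apply_time k
      have h2 := hc (q k) hk'.le
      exact he.symm.trans (h2.symm.trans h1)
    refine hmin (k - 1) (by omega) fun i' hi' => ?_
    have hprev : obsC (s (k - 1)) = obsC (s k) := by
      rcases lt_or_ge (q (k - 1)) k' with hlt | hge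
      · have h3 := h.apply_of_lt (k - 1) k' hlt.le
          (by rwa [Nat.sub_add_cancel (by omega)])
        exact h3.symm.trans (he.trans hik)
      · exact (h.apply_time (k - 1)).symm.trans ((hc _ hge).trans (he.trans hik))
    rcases hi'.eq_or_lt with rfl | hlt
    · rfl
    · exact (hk i' (by omega)).trans hprev.symm
  · refine Or.inr ⟨fun ⟨k, hk⟩ => hnc ?_, fun i => q (φ i), ?_, ?_, ?_, ?_, ?_⟩
    · obtain ⟨i, hi⟩ := hq k
      exact ⟨i, (h.eventually_const_iff hq i).1 fun j hj =>
        (hk j (hi.trans hj)).trans (hk _ hi).symm⟩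
    · refine strictMono_nat_of_lt_succ fun i => lt_of_le_of_ne (h.mono (hφ (Nat.lt_succ_self i)).le)
        fun he => hne i ?_
      have h1 := h.apply_time (φ i)
      have h2 := h.apply_time (φ (i + 1))
      rw [he] at h1
      exact h2.symm.trans h1
    · simp [hφ0, h.zero]
    · intro i j hj hj'
      obtain ⟨r, hr, hr', he⟩ := h.exists_block (hφ (Nat.lt_succ_self i)).le hj hj'
      exact he.trans ((hconst i r hr hr').trans (h.apply_time (φ i)).symm)
    · intro i he
      exact hne i ((h.apply_time _).symm.trans (he.trans (h.apply_time _)))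
    · congr 1
      funext i
      exact (h.apply_time _).symm

end Retimes

/-- A path of `n` steps from `x` to `y` along which the observation changes at most once. -/
def SinglePath {α O : Type} (A : ActionSystem α) (obs : α → O) (x y : α) (n : ℕ) : Prop :=
  ∃ g : ℕ → α, g 0 = x ∧ g n = y ∧ (∀ i, i < n → A.step (g i) (g (i + 1))) ∧
    ∃ m, m ≤ n ∧ (∀ i, i < m → obs (g i) = obs (g 0)) ∧
      ∀ i, m ≤ i → i ≤ n → obs (g i) = obs (g n)

theorem SinglePath.refl {α O : Type} (A : ActionSystem α) (obs : α → O) (x : α) :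
    SinglePath A obs x x 0 :=
  ⟨fun _ => x, rfl, rfl, by simp, 0, le_rfl, by simp, by simp⟩

/-- Consecutive paths can be glued into a single run. -/
theorem exists_glued_run {α O : Type} {A : ActionSystem α} {obs : α → O} {x : ℕ → α} {n : ℕ → ℕ}
    (hpath : ∀ i, SinglePath A obs (x i) (x (i + 1)) (n i)) {p : ℕ → ℕ} (hp0 : p 0 = 0)
    (hp : ∀ i, p (i + 1) = p i + n i) :
    ∃ (t : ℕ → α) (q : ℕ → ℕ), (∀ i, t (p i) = x i) ∧
      (∀ i j, j < p i → A.step (t j) (t (j + 1))) ∧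
      Retimes (fun i => obs (x i)) (fun j => obs (t j)) q ∧
      (∀ i, q i ≤ p i ∧ p i ≤ q (i + 1)) ∧
      ∀ i j, q i ≤ j → j ≤ p i → obs (t j) = obs (x i) := by
  choose g hg0 hgn hgs m hmn hg1 hg2 using hpath
  have hpm : Monotone p := monotone_nat_of_le_succ fun i => by rw [hp]; omega
  have hx : ∀ i i', i ≤ i' → p i = p i' → x i = x i' := by
    intro i i' hii'
    induction i', hii' using Nat.le_induction with
    | base => simp
    | succ k hik ih =>
      intro he
      have h1 := hpm hik
      have h2 := hp k
      have h3 : n k = 0 := by omega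
      rw [ih (by omega), ← hgn k, h3, hg0]
  have hlt : ∀ i i' k k', i < i' → k ≤ n i → p i + k = p i' + k' → g i k = g i' k' := by
    intro i i' k k' hi hk he
    have h1 := hpm (Nat.succ_le_of_lt hi)
    have h2 := hp i
    simp only [Nat.succ_eq_add_one] at h1
    have hk' : k' = 0 := by omega
    have hkn : k = n i := by omega
    rw [hk', hkn, hgn, hg0]
    exact hx _ _ hi (by omega)
  have huniq : ∀ i i' k k', k ≤ n i → k' ≤ n i' → p i + k = p i' + k' → g i k = g i' k' := by
    intro i i' k k' hk hk' he
    rcases lt_trichotomy i i' with h | rfl | h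
    · exact hlt _ _ _ _ h hk he
    · rw [Nat.add_left_cancel he]
    · exact (hlt _ _ _ _ h hk' he.symm).symm
  have hex : ∀ j, ∃ y, ∀ i k, k ≤ n i → p i + k = j → y = g i k := by
    intro j
    by_cases h : ∃ i k, k ≤ n i ∧ p i + k = j
    · obtain ⟨i, k, hk, rfl⟩ := h
      exact ⟨g i k, fun i' k' hk' he => huniq _ _ _ _ hk hk' he.symm⟩
    · exact ⟨x 0, fun i k hk he => absurd ⟨i, k, hk, he⟩ h⟩
  choose t ht using hex
  have htg : ∀ i k, k ≤ n i → t (p i + k) = g i k := fun i k hk => ht _ i k hk rfl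
  have htp : ∀ i, t (p i) = x i := fun i => (htg i 0 (Nat.zero_le _)).trans (hg0 i)
  let q : ℕ → ℕ := fun i => Nat.casesOn i 0 fun i => p i + m i
  have hqs : ∀ i, q (i + 1) = p i + m i := fun _ => rfl
  have hqp : ∀ i, q i ≤ p i ∧ p i ≤ q (i + 1) := by
    intro i
    refine ⟨?_, by rw [hqs]; omega⟩
    cases i with
    | zero => exact Nat.zero_le _
    | succ i =>
      have := hmn i
      rw [hqs, hp]; omega
  have hobs : ∀ i j, q i ≤ j → j ≤ p i → obs (t j) = obs (x i) := by
    intro i j hj hj'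
    cases i with
    | zero =>
      have : j = p 0 := by omega
      rw [this, htp]
    | succ i =>
      rw [hqs] at hj
      rw [hp] at hj'
      obtain ⟨k, rfl⟩ : ∃ k, j = p i + k := ⟨j - p i, by omega⟩
      rw [htg i k (by omega), hg2 i k (by omega) (by omega), hgn]
  refine ⟨t, q, htp, ?_, ⟨monotone_nat_of_le_succ fun i => (hqp i).1.trans (hqp i).2, rfl,
    fun i => hobs i _ le_rfl (hqp i).1, fun i j hj hj' => ?_⟩, hqp, hobs⟩
  · intro i
    induction i with
    | zero => intro j hj; omega
    | succ i ih =>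
      intro j hj
      by_cases hji : j < p i
      · exact ih j hji
      · rw [hp] at hj
        obtain ⟨k, rfl⟩ : ∃ k, j = p i + k := ⟨j - p i, by omega⟩
        rw [add_assoc, htg i k (by omega), htg i (k + 1) (by omega)]
        exact hgs i k (by omega)
  · rcases le_or_gt j (p i) with hle | hgt
    · exact hobs i j hj hle
    · rw [hqs] at hj'
      have := hmn i
      obtain ⟨k, rfl⟩ : ∃ k, j = p i + k := ⟨j - p i, by omega⟩
      change obs (t (p i + k)) = obs (x i)
      rw [htg i k (by omega), hg1 i k (by omega), hg0]

/-- If every point of the `(i + 1)`-st set has an `E i`-predecessor in the `i`-th set, then any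
point of the `N`-th set is the end of a chain of length `N`. -/
theorem exists_backward_chain {α : Type} {P : ℕ → α → Prop} {E : ℕ → α → α → Prop} (N : ℕ)
    (hback : ∀ i < N, ∀ y, P (i + 1) y → ∃ x, P i x ∧ E i x y) :
    ∀ y, P N y → ∃ x : ℕ → α, (∀ i, N ≤ i → x i = y) ∧ (∀ i ≤ N, P i (x i)) ∧
      ∀ i < N, E i (x i) (x (i + 1)) := by
  induction N with
  | zero =>
    intro y hy
    refine ⟨fun _ => y, by simp, fun i hi => ?_, by simp⟩
    obtain rfl : i = 0 := by omega
    exact hy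
  | succ N ih =>
    intro y hy
    obtain ⟨z, hz, hzy⟩ := hback N (Nat.lt_succ_self N) y hy
    obtain ⟨x, hx, hP, hE⟩ := ih (fun i hi => hback i (by omega)) z hz
    refine ⟨fun i => if i ≤ N then x i else y, fun i hi => if_neg (by omega), fun i hi => ?_,
      fun i hi => ?_⟩
    · by_cases h : i ≤ N
      · simpa [h] using hP i h
      · obtain rfl : i = N + 1 := by omega
        simpa using hy
    · by_cases h : i < N
      · simpa [h, h.le, Nat.succ_le_of_lt h] using hE i h
      · obtain rfl : i = N := by omega
        simpa [hx i le_rfl] using hzy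

/-- König's lemma for backward chains through finite nonempty sets. -/
theorem exists_infinite_chain {α : Type} {P : ℕ → α → Prop} {E : ℕ → α → α → Prop}
    (hne : ∀ i, ∃ x, P i x) (hfin : ∀ i, {x | P i x}.Finite)
    (hback : ∀ i y, P (i + 1) y → ∃ x, P i x ∧ E i x y) :
    ∃ x : ℕ → α, (∀ i, P i (x i)) ∧ ∀ i, E i (x i) (x (i + 1)) := by
  have hchain : ∀ N, ∃ x : ℕ → α, (∀ i ≤ N, P i (x i)) ∧ ∀ i < N, E i (x i) (x (i + 1)) := by
    intro N
    obtain ⟨y, hy⟩ := hne N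
    obtain ⟨x, -, hx⟩ := exists_backward_chain N (fun i _ => hback i) y hy
    exact ⟨x, hx⟩
  choose c hcP hcE using hchain
  let U : Ultrafilter ℕ := Filter.hyperfilter ℕ
  have hU : ∀ i, ∀ᶠ N in (U : Filter ℕ), i < N := fun i =>
    Nat.hyperfilter_le_atTop (Filter.eventually_gt_atTop i)
  have hlim : ∀ i, ∃ x, P i x ∧ ∀ᶠ N in (U : Filter ℕ), c N i = x := by
    intro i
    have h : (⋃ x ∈ {x | P i x}, {N | c N i = x}) ∈ U := by
      filter_upwards [hU i] with N hN
      simpa using hcP N i hN.le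
    rw [Ultrafilter.finite_biUnion_mem_iff (hfin i)] at h
    exact h
  choose x hxP hx using hlim
  refine ⟨x, hxP, fun i => ?_⟩
  obtain ⟨N, h1, h2, h3⟩ := ((hx i).and ((hx (i + 1)).and (hU i))).exists
  rw [← h1, ← h2]
  exact hcE N i h3

theorem List.exists_eq_map_range {γ : Type} {l : List γ} (hl : l ≠ []) :
    ∃ (N : ℕ) (s : ℕ → γ), l = (List.range (N + 1)).map s := by
  have hpos := List.length_pos_iff.2 hl
  refine ⟨l.length - 1, fun i => l.getD i (l.head hl), List.ext_getElem (by simp; omega) ?_⟩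
  intro i h1 h2
  simp [h1]

theorem isCompleteTrace_map_range_iff {σ : Type} {A : ActionSystem σ} {N : ℕ} {s : ℕ → σ} :
    IsCompleteTrace A (.fin ((List.range (N + 1)).map s)) ↔
      s 0 ∈ A.init ∧ (∀ i < N, A.step (s i) (s (i + 1))) ∧ ¬ A.Enabled (s N) := by
  have hne : (List.range (N + 1)).map s ≠ [] := by simp
  have hc : ((List.range (N + 1)).map s).IsChain A.step ↔ ∀ i < N, A.step (s i) (s (i + 1)) := by
    simp [List.isChain_iff_getElem]
  have hh : ((List.range (N + 1)).map s).head hne = s 0 := by simp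
  have hl : ((List.range (N + 1)).map s).getLast hne = s N := by simp
  constructor
  · rintro ⟨_, h1, h2, h3⟩
    exact ⟨hh ▸ h1, hc.1 h2, hl ▸ h3⟩
  · rintro ⟨h1, h2, h3⟩
    exact ⟨hne, hh.symm ▸ h1, hc.2 h2, hl.symm ▸ h3⟩

/-- Backward simulation (Lemma 2) implies trace refinement, for continuous abstract systems. -/
theorem backward_simulation_implies_trace_refinement
    {α γ O : Type} (A : ActionSystem α) (obsA : α → O)
    (C : ActionSystem γ) (obsC : γ → O)
    (hCont : ∀ σ, {σ' | A.step σ σ'}.Finite)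
    (R : α → γ → Prop) (V : γ → ℕ)
    (hTotal : ∀ τ, ∃ σ, R σ τ)
    (hImFin : ∀ τ, {σ | R σ τ}.Finite)
    (hInit : ∀ τ ∈ C.init, ∀ σ, R σ τ → σ ∈ A.init)
    (hObs : ∀ σ τ, R σ τ → obsA σ = obsC τ)
    (hStep : ∀ τ τ' σ', C.step τ τ' → R σ' τ' →
      ∃ (n : ℕ) (g : ℕ → α), g n = σ' ∧ R (g 0) τ ∧
        (∀ i, i < n → A.step (g i) (g (i + 1))) ∧
        (∃ m, m ≤ n ∧ (∀ i, i < m → obsA (g i) = obsA (g 0)) ∧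
          (∀ i, m ≤ i → i ≤ n → obsA (g i) = obsA (g n))) ∧
        (n = 0 → V τ' < V τ))
    (hGrd : ∀ τ, ¬ C.Enabled τ → ∃ σ, R σ τ ∧ ¬ A.Enabled σ) :
    TraceRefines A obsA C obsC := by
  have hback : ∀ τ τ' y, C.step τ τ' → R y τ' →
      ∃ x, R x τ ∧ ∃ n, SinglePath A obsA x y n ∧ (n = 0 → V τ' < V τ) := by
    intro τ τ' y hs hy
    obtain ⟨n, g, hgn, hg0, hgs, hm, hV⟩ := hStep τ τ' y hs hy
    exact ⟨g 0, hg0, n, ⟨g, rfl, hgn, hgs, hm⟩, hV⟩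
  rintro (l | s) hs ot hot
  · obtain ⟨N, s, rfl⟩ := List.exists_eq_map_range hs.1
    obtain ⟨hs0, hss, hsN⟩ := isCompleteTrace_map_range_iff.1 hs
    obtain ⟨y, hy, hyE⟩ := hGrd _ hsN
    obtain ⟨x, hxN, hxR, hxE⟩ := exists_backward_chain (P := fun i z => R z (s i))
      (E := fun _ u v => ∃ n, SinglePath A obsA u v n) N
      (fun i hi z hz => by
        obtain ⟨u, hu, n, hn, -⟩ := hback _ _ z (hss i hi) hz
        exact ⟨u, hu, n, hn⟩) y hy
    have hpath : ∀ i, ∃ n, SinglePath A obsA (x i) (x (i + 1)) n := by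
      intro i
      rcases lt_or_ge i N with h | h
      · exact hxE i h
      · rw [hxN i h, hxN (i + 1) (by omega)]
        exact ⟨0, .refl A obsA y⟩
    choose n hn using hpath
    obtain ⟨t, q, htp, hts, hq, hqp, hobs⟩ := exists_glued_run hn
      (p := fun i => ∑ j ∈ Finset.range i, n j) (by simp) fun i => Finset.sum_range_succ n i
    set p : ℕ → ℕ := fun i => ∑ j ∈ Finset.range i, n j with hp
    have ht0 : t 0 = x 0 := by simpa [hp] using htp 0
    refine ⟨.fin ((List.range (p N + 1)).map t), isCompleteTrace_map_range_iff.2 ⟨?_, ?_, ?_⟩, ?_⟩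
    · rw [ht0]
      exact hInit _ hs0 _ (hxR 0 (Nat.zero_le N))
    · exact fun j hj => hts N j hj
    · rwa [htp, hxN N le_rfl]
    · have hot' : ot = .fin (destutter (((List.range (N + 1)).map s).map obsC)) := hot
      have hA : destutterUpTo (fun j => obsA (t j)) (p N) =
          destutterUpTo (fun i => obsA (x i)) N := by
        rw [← hq.destutterUpTo_eq N]
        exact destutterUpTo_eq_of_const (hqp N).1 fun j hj hj' =>
          (hobs N j hj hj').trans (hq.apply_time N).symm
      have hAC : destutterUpTo (fun i => obsA (x i)) N =
          destutterUpTo (fun i => obsC (s i)) N := by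
        refine congrArg destutter (List.map_congr_left fun i hi => hObs _ _ (hxR i ?_))
        have := List.mem_range.1 hi
        omega
      change ot = .fin (destutter (((List.range (p N + 1)).map t).map obsA))
      rw [hot', List.map_map, List.map_map]
      exact congrArg ObsTrace.fin (hA.trans hAC).symm
  · obtain ⟨hs0, hss⟩ := hs
    obtain ⟨x, hxR, hxE⟩ := exists_infinite_chain (P := fun i z => R z (s i))
      (E := fun i u v => ∃ n, SinglePath A obsA u v n ∧ (n = 0 → V (s (i + 1)) < V (s i)))
      (fun i => hTotal _) (fun i => hImFin _) fun i y hy => hback _ _ y (hss i) hy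
    choose n hn hV using hxE
    obtain ⟨t, q, htp, hts, hq, hqp, -⟩ := exists_glued_run hn
      (p := fun i => ∑ j ∈ Finset.range i, n j) (by simp) fun i => Finset.sum_range_succ n i
    set p : ℕ → ℕ := fun i => ∑ j ∈ Finset.range i, n j with hp
    have hps : ∀ i, p (i + 1) = p i + n i := fun i => Finset.sum_range_succ n i
    have hgrow : ∀ i, ∃ j, p i < p j := by
      intro i
      by_contra! hle
      have hdesc : ∀ k, p (i + k) = p i ∧ V (s (i + k)) + k ≤ V (s i) := by
        intro k
        induction k with
        | zero => simp
        | succ k ih =>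
          have h1 := hle (i + (k + 1))
          have h2 := hps (i + k)
          rw [← add_assoc] at h1 ⊢
          have h3 := hV (i + k) (by omega)
          omega
      have := (hdesc (V (s i) + 1)).2
      omega
    have hunb : ∀ B, ∃ i, B ≤ p i := by
      intro B
      induction B with
      | zero => exact ⟨0, Nat.zero_le _⟩
      | succ B ih =>
        obtain ⟨i, hi⟩ := ih
        obtain ⟨j, hj⟩ := hgrow i
        exact ⟨j, by omega⟩
    have ht0 : t 0 = x 0 := by simpa [hp] using htp 0
    refine ⟨.inf t, ⟨?_, fun j => ?_⟩, ?_⟩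
    · rw [ht0]
      exact hInit _ hs0 _ (hxR 0)
    · obtain ⟨i, hi⟩ := hunb (j + 1)
      exact hts i j hi
    · have hoi : (fun i => obsA (x i)) = fun i => obsC (s i) :=
        funext fun i => hObs _ _ (hxR i)
      rw [hoi] at hq
      refine hq.trOf (fun B => ?_) hot
      obtain ⟨i, hi⟩ := hunb B
      exact ⟨i + 1, hi.trans (hqp i).2⟩
end

section
/- (Positive half of the counterexample proving Theorem 4.) Let h₁ be the complete history ⟨inv(1,push,1), ret(1,push,⊥), inv(1,push,2), ret(1,push,⊥), inv(1,pop,⊥), ret(1,pop,1), inv(2,pop,⊥), ret(2,pop,2)⟩. Then h₁ satisfies sequential consistency with respect to the stack: there exists a mapping function f with VMF(h₁,f), sc(h₁,f), total(h₁,f), and map(h₁,f) a legal sequential stack history from the empty stack [] (a witness maps the events in the abstract order push(1), push(2), pop→2, pop→1). -/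
/-- Operation names of the stack object. -/
inductive Op where
  | push | pop
  deriving DecidableEq

/-- Values together with the distinguished symbols `⊥` (no input/output) and `empty`. -/
inductive EVal where
  | val : ℕ → EVal
  | bot | empty
  deriving DecidableEq

/-- Invocation and return events (thread identifier, operation name, input/output value). -/
inductive Event where
  | inv : ℕ → Op → EVal → Event
  | ret : ℕ → Op → EVal → Event
  deriving DecidableEq

/-- The thread of an event. -/
def Event.thread : Event → ℕ
  | .inv t _ _ => t
  | .ret t _ _ => t

/-- `mp m n h`: indices `m < n` form a matching pair in history `h`. -/
def mp (m n : ℕ) (h : List Event) : Prop :=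
  m < n ∧ n < h.length ∧
    ∃ t o u v, h[m]? = some (Event.inv t o u) ∧ h[n]? = some (Event.ret t o v) ∧
      ∀ i e, m < i → i < n → h[i]? = some e → e.thread ≠ t

/-- `pi m h`: index `m` is a pending invocation in history `h`. -/
def pi (m : ℕ) (h : List Event) : Prop :=
  m < h.length ∧ ∀ n, m < n → n < h.length →
    ¬ ∃ t o u v, h[m]? = some (Event.inv t o u) ∧ h[n]? = some (Event.ret t o v)

/-- `VMF h f`: `f` (a partial function on indices, modelled via `Option`) is a valid
mapping function for history `h`. -/
def VMF (h : List Event) (f : ℕ → Option ℕ) : Prop :=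
  (∀ m k, f m = some k → m < h.length) ∧
  (∃ n, ∀ k, (∃ m, f m = some k) ↔ k < n) ∧
  (∀ m m' k, f m = some k → f m' = some k → m = m') ∧
  (∀ m n, mp m n h → ((∃ k, f m = some k) ↔ ∃ k, f n = some k)) ∧
  (∀ m n k, mp m n h → f m = some k → f n = some (k + 1))

/-- `mapped h f g`: `g` is the mapped history `map(h,f)`, i.e. the sequence of length
`|ran f|` whose element at position `f.k` is `h.k`. -/
def mapped (h : List Event) (f : ℕ → Option ℕ) (g : List Event) : Prop :=
  (∀ k, k < g.length ↔ ∃ m, f m = some k) ∧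
  (∀ m k, f m = some k → g[k]? = h[m]?)

/-- `total h f`: every non-pending index of `h` is in the domain of `f`. -/
def total (h : List Event) (f : ℕ → Option ℕ) : Prop :=
  ∀ m, m < h.length → ¬ pi m h → ∃ k, f m = some k

/-- The event at index `m` of `h` is a return event. -/
def isRetAt (h : List Event) (m : ℕ) : Prop :=
  ∃ t o v, h[m]? = some (Event.ret t o v)

/-- The event at index `m` of `h` is an invocation event. -/
def isInvAt (h : List Event) (m : ℕ) : Prop :=
  ∃ t o v, h[m]? = some (Event.inv t o v)

/-- Linearizability ordering condition. -/
def lin (h : List Event) (f : ℕ → Option ℕ) : Prop :=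
  ∀ m n km kn, f m = some km → f n = some kn → m < n →
    isRetAt h m → isInvAt h n → km < kn

/-- Sequential consistency ordering condition (per-thread order preserved). -/
def sc (h : List Event) (f : ℕ → Option ℕ) : Prop :=
  ∀ m n km kn, f m = some km → f n = some kn → m < n →
    (∃ t o v o' v', h[m]? = some (Event.ret t o v) ∧ h[n]? = some (Event.inv t o' v')) →
    km < kn

/-- `qp m h`: index `m` is a quiescent point of `h`. -/
def qp (m : ℕ) (h : List Event) : Prop :=
  ∀ n, n ≤ m → ¬ pi n (h.take (m + 1))

/-- Quiescent consistency ordering condition (order across quiescent points preserved). -/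
def qc (h : List Event) (f : ℕ → Option ℕ) : Prop :=
  ∀ m k n km kk kn, f m = some km → f k = some kk → f n = some kn →
    m < k → k < n → qp k h → km < kn

/-- Legal sequential stack histories starting from stack contents `S`. -/
inductive LegalStack : List ℕ → List Event → Prop where
  | nil (S : List ℕ) : LegalStack S []
  | push (S : List ℕ) (t v : ℕ) (r : List Event) :
      LegalStack (v :: S) r →
      LegalStack S (Event.inv t Op.push (EVal.val v) :: Event.ret t Op.push EVal.bot :: r)
  | popEmpty (t : ℕ) (r : List Event) :
      LegalStack [] r →
      LegalStack [] (Event.inv t Op.pop EVal.bot :: Event.ret t Op.pop EVal.empty :: r)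
  | pop (S : List ℕ) (t v : ℕ) (r : List Event) :
      LegalStack S r →
      LegalStack (v :: S) (Event.inv t Op.pop EVal.bot :: Event.ret t Op.pop (EVal.val v) :: r)

/-- The history `h₁` of the counterexample for sequential consistency (Theorem 4). -/
def h₁ : List Event :=
  [Event.inv 1 Op.push (EVal.val 1), Event.ret 1 Op.push EVal.bot,
   Event.inv 1 Op.push (EVal.val 2), Event.ret 1 Op.push EVal.bot,
   Event.inv 1 Op.pop EVal.bot, Event.ret 1 Op.pop (EVal.val 1),
   Event.inv 2 Op.pop EVal.bot, Event.ret 2 Op.pop (EVal.val 2)]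

theorem mp_h₁ {m n : ℕ} (h : mp m n h₁) :
    n = m + 1 ∧ (m = 0 ∨ m = 2 ∨ m = 4 ∨ m = 6) := by
  obtain ⟨hmn, hn, t, o, u, v, hm, hr, hi⟩ := h
  have hn8 : n < 8 := hn
  have hm8 : m < 8 := by omega
  have hnext : n ≠ m + 1 → ∀ e, h₁[m + 1]? = some e → e.thread ≠ t := fun hne e he =>
    hi (m + 1) e (by omega) (by omega) he
  interval_cases m <;> simp [h₁, Event.thread] at hm hnext ⊢ <;> obtain ⟨rfl, rfl, rfl⟩ := hm <;>
    simp at hnext <;> exact hnext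

/-- The mapping of `h₁` that swaps its two pop operations. -/
def swapPops (m : ℕ) : Option ℕ :=
  if m < 4 then some m else if m < 6 then some (m + 2) else if m < 8 then some (m - 2) else none

theorem swapPops_eq_some {m k : ℕ} :
    swapPops m = some k ↔
      (m < 4 ∧ k = m) ∨ (4 ≤ m ∧ m < 6 ∧ k = m + 2) ∨ (6 ≤ m ∧ m < 8 ∧ k + 2 = m) := by
  unfold swapPops
  split_ifs <;> simp <;> omega

theorem exists_swapPops_eq_some {k : ℕ} : (∃ m, swapPops m = some k) ↔ k < 8 := by
  simp only [swapPops_eq_some]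
  refine ⟨fun ⟨m, hm⟩ => by omega, fun hk => ?_⟩
  exact ⟨if k < 4 then k else if k < 6 then k + 2 else k - 2, by split_ifs <;> omega⟩

theorem swapPops_dom {m : ℕ} (hm : m < 8) : ∃ k, swapPops m = some k := by
  unfold swapPops
  split_ifs <;> simp

theorem VMF_swapPops : VMF h₁ swapPops := by
  refine ⟨fun m k h => ?_, ⟨8, fun k => exists_swapPops_eq_some⟩, fun m m' k h h' => ?_,
    fun m n h => ?_, fun m n k h hk => ?_⟩
  · change m < 8
    rw [swapPops_eq_some] at h
    omega
  · rw [swapPops_eq_some] at h h'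
    omega
  · obtain ⟨rfl, hm⟩ := mp_h₁ h
    exact iff_of_true (swapPops_dom (by omega)) (swapPops_dom (by omega))
  · obtain ⟨rfl, hm⟩ := mp_h₁ h
    rw [swapPops_eq_some] at hk ⊢
    omega

theorem sc_swapPops : sc h₁ swapPops := by
  rintro m n km kn hm hn hmn ⟨t, o, v, o', v', hr, hi⟩
  rw [swapPops_eq_some] at hm hn
  by_contra hlt
  have h₄ : m = 4 ∨ m = 5 := by omega
  have h₆ : n = 6 ∨ n = 7 := by omega
  rcases h₄ with rfl | rfl <;> rcases h₆ with rfl | rfl <;> simp [h₁] at hr hi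
  omega

/-- `h₁` is sequentially consistent with respect to the stack. -/
theorem h₁_sequentially_consistent :
    ∃ (f : ℕ → Option ℕ) (g : List Event),
      VMF h₁ f ∧ sc h₁ f ∧ total h₁ f ∧ mapped h₁ f g ∧ LegalStack [] g := by
  refine ⟨swapPops,
    [Event.inv 1 Op.push (EVal.val 1), Event.ret 1 Op.push EVal.bot,
     Event.inv 1 Op.push (EVal.val 2), Event.ret 1 Op.push EVal.bot,
     Event.inv 2 Op.pop EVal.bot, Event.ret 2 Op.pop (EVal.val 2),
     Event.inv 1 Op.pop EVal.bot, Event.ret 1 Op.pop (EVal.val 1)],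
    VMF_swapPops, sc_swapPops, fun m hm _ => swapPops_dom hm,
    ⟨fun k => exists_swapPops_eq_some.symm, fun m k h => ?_⟩, ?_⟩
  · rw [swapPops_eq_some] at h
    have hm : m < 8 := by omega
    interval_cases m <;> simp at h <;> subst h <;> rfl
  · exact .push _ _ _ _ (.push _ _ _ _ (.pop _ _ _ _ (.pop _ _ _ _ (.nil _))))
end

section
/- (Negative half of the counterexample proving Theorem 4.) Let h₁ be the complete history ⟨inv(1,push,1), ret(1,push,⊥), inv(1,push,2), ret(1,push,⊥), inv(1,pop,⊥), ret(1,pop,1), inv(2,pop,⊥), ret(2,pop,2)⟩. Then h₁ is not linearizable with respect to the stack: there is no mapping function f with VMF(h₁,f), lin(h₁,f), total(h₁,f), and map(h₁,f) a legal sequential stack history from the empty stack []. (Since all operation calls in h₁ are non-overlapping, lin forces map(h₁,f) to keep the real-time order, in which the first pop would have to return 2, not 1.) -/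
/-- `h₁` is not linearizable with respect to the stack. -/
theorem h₁_not_linearizable :
    ¬ ∃ (f : ℕ → Option ℕ) (g : List Event),
        VMF h₁ f ∧ lin h₁ f ∧ total h₁ f ∧ mapped h₁ f g ∧ LegalStack [] g := by
  rintro ⟨f, g, ⟨hdom, ⟨n, hran⟩, -, -, hsucc⟩, hlin, htotal, ⟨-, hmap⟩, hlegal⟩
  have mp_h₁ : ∀ m < 4, mp (2 * m) (2 * m + 1) h₁ := by
    intro m hm
    refine ⟨by omega, by simp only [h₁, List.length_cons, List.length_nil]; omega, ?_⟩
    interval_cases m <;> exact ⟨_, _, _, _, rfl, rfl, by omega⟩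
  have inv_mem_dom : ∀ m < 4, ∃ k, f (2 * m) = some k := by
    intro m hm
    obtain ⟨h_lt, h_len, t, o, u, v, h_inv, h_ret, -⟩ := mp_h₁ m hm
    exact htotal _ (h_lt.trans h_len) fun hp => hp.2 _ h_lt h_len ⟨t, o, u, v, h_inv, h_ret⟩
  obtain ⟨a, ha⟩ := inv_mem_dom 0 (by omega)
  obtain ⟨b, hb⟩ := inv_mem_dom 1 (by omega)
  obtain ⟨c, hc⟩ := inv_mem_dom 2 (by omega)
  obtain ⟨d, hd⟩ := inv_mem_dom 3 (by omega)
  have ha' := hsucc _ _ _ (mp_h₁ 0 (by omega)) ha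
  have hb' := hsucc _ _ _ (mp_h₁ 1 (by omega)) hb
  have hc' := hsucc _ _ _ (mp_h₁ 2 (by omega)) hc
  have hd' := hsucc _ _ _ (mp_h₁ 3 (by omega)) hd
  norm_num at ha hb hc hd ha' hb' hc' hd'
  have hab : a + 1 < b := hlin _ _ _ _ ha' hb (by omega) ⟨_, _, _, rfl⟩ ⟨_, _, _, rfl⟩
  have hbc : b + 1 < c := hlin _ _ _ _ hb' hc (by omega) ⟨_, _, _, rfl⟩ ⟨_, _, _, rfl⟩
  have hcd : c + 1 < d := hlin _ _ _ _ hc' hd (by omega) ⟨_, _, _, rfl⟩ ⟨_, _, _, rfl⟩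
  have hcn : c < n := (hran c).1 ⟨_, hc⟩
  have values : ∀ k < n, k = a ∨ k = a + 1 ∨ k = b ∨ k = b + 1 ∨ k = c ∨ k = c + 1 ∨
      k = d ∨ k = d + 1 := by
    intro k hk
    obtain ⟨m, hm⟩ := (hran k).2 hk
    have hm8 : m < 8 := hdom m k hm
    interval_cases m <;> simp_all
  obtain rfl : a = 0 := by have := values 0 (by omega); omega
  obtain rfl : b = 2 := by
    by_contra hne
    have := values 2 (by omega)
    omega
  obtain rfl : c = 4 := by
    by_contra hne
    have := values 4 (by omega)
    omega
  have g0 := hmap _ _ ha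
  have g2 := hmap _ _ hb
  have g4 := hmap _ _ hc
  have g5 := hmap _ _ hc'
  clear hmap hlin hsucc hran hdom htotal values mp_h₁ inv_mem_dom
  cases hlegal <;> simp [h₁] at g0 g2 g4 g5
  rename_i r₁ hr₁
  cases hr₁ <;> simp at g2 g4 g5
  rename_i r₂ hr₂
  cases hr₂ <;> simp_all
end

section
/- (Negative half of the counterexample proving Theorem 5.) Let h₂ be the complete history ⟨inv(2,pop,⊥), inv(1,push,1), ret(1,push,⊥), inv(1,push,2), ret(1,push,⊥), inv(1,pop,⊥), ret(1,pop,1), inv(1,pop,⊥), ret(1,pop,2), inv(1,push,3), ret(1,push,⊥), ret(2,pop,3)⟩. Then h₂ does not satisfy sequential consistency with respect to the stack: there is no mapping function f with VMF(h₂,f), sc(h₂,f), total(h₂,f), and map(h₂,f) a legal sequential stack history from the empty stack []. (sc forces thread 1's calls to appear in map(h₂,f) in the order push(1), push(2), pop→1, pop→2, push(3), and no insertion position for thread 2's pop→3 makes this a legal stack history.) -/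
/-- The history `h₂` of the counterexample for quiescent consistency (Theorem 5). -/
def h₂ : List Event :=
  [Event.inv 2 Op.pop EVal.bot,
   Event.inv 1 Op.push (EVal.val 1), Event.ret 1 Op.push EVal.bot,
   Event.inv 1 Op.push (EVal.val 2), Event.ret 1 Op.push EVal.bot,
   Event.inv 1 Op.pop EVal.bot, Event.ret 1 Op.pop (EVal.val 1),
   Event.inv 1 Op.pop EVal.bot, Event.ret 1 Op.pop (EVal.val 2),
   Event.inv 1 Op.push (EVal.val 3), Event.ret 1 Op.push EVal.bot,
   Event.ret 2 Op.pop (EVal.val 3)]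

/-- The invocation `m` and its matching return `n` occupy consecutive positions of the mapped
history. -/
theorem exists_mapped_pair {h : List Event} {f : ℕ → Option ℕ} (hV : VMF h f) (hT : total h f)
    {m n : ℕ} (hmp : mp m n h) : ∃ k, f m = some k ∧ f n = some (k + 1) := by
  obtain ⟨-, -, -, -, hV5⟩ := hV
  have hmp' := hmp
  obtain ⟨hmn, hn, t, o, u, v, hu, hv, -⟩ := hmp'
  obtain ⟨k, hk⟩ := hT m (by omega) fun hpi => hpi.2 n hmn hn ⟨t, o, u, v, hu, hv⟩
  exact ⟨k, hk, hV5 m n k hmp hk⟩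

/-- A pop returning `v` is legal only if `v` is on top of the stack. -/
theorem LegalStack.of_pop {S : List ℕ} {g : List Event} {t t' v : ℕ} (hL : LegalStack S g)
    (h0 : g[0]? = some (Event.inv t Op.pop EVal.bot))
    (h1 : g[1]? = some (Event.ret t' Op.pop (EVal.val v))) : S.head? = some v := by
  cases hL <;> simp_all

/-- After a push, the rest of the history is legal from the extended stack. -/
theorem LegalStack.of_push {S : List ℕ} {g : List Event} {t v : ℕ} (hL : LegalStack S g)
    (h0 : g[0]? = some (Event.inv t Op.push (EVal.val v))) :
    LegalStack (v :: S) (g.drop 2) := by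
  cases hL <;> simp_all

/-- `h₂` is not sequentially consistent with respect to the stack. -/
theorem h₂_not_sequentially_consistent :
    ¬ ∃ (f : ℕ → Option ℕ) (g : List Event),
        VMF h₂ f ∧ sc h₂ f ∧ total h₂ f ∧ mapped h₂ f g ∧ LegalStack [] g := by
  rintro ⟨f, g, hV, hsc, hT, ⟨hlen, hg⟩, hL⟩
  have pair_one : ∀ m u v o, h₂[m]? = some (Event.inv 1 o u) →
      h₂[m + 1]? = some (Event.ret 1 o v) → ∃ k, f m = some k ∧ f (m + 1) = some (k + 1) := by
    intro m u v o hu hv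
    exact exists_mapped_pair hV hT ⟨by omega, (List.getElem?_eq_some_iff.1 hv).1,
      1, o, u, v, hu, hv, fun i e _ _ => by omega⟩
  obtain ⟨a, ha, ha'⟩ : ∃ k, f 0 = some k ∧ f 11 = some (k + 1) := by
    refine exists_mapped_pair hV hT ⟨by omega, by simp [h₂], 2, _, _, _, rfl, rfl, ?_⟩
    intro i e h1 h2 he
    interval_cases i <;> simp [h₂] at he <;> subst he <;> simp [Event.thread]
  obtain ⟨b₁, hb₁, hb₁'⟩ := pair_one 1 _ _ _ rfl rfl
  obtain ⟨b₂, hb₂, hb₂'⟩ := pair_one 3 _ _ _ rfl rfl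
  obtain ⟨b₃, hb₃, hb₃'⟩ := pair_one 5 _ _ _ rfl rfl
  obtain ⟨b₄, hb₄, hb₄'⟩ := pair_one 7 _ _ _ rfl rfl
  obtain ⟨b₅, hb₅, hb₅'⟩ := pair_one 9 _ _ _ rfl rfl
  have h12 := hsc _ _ _ _ hb₁' hb₂ (by omega) ⟨_, _, _, _, _, rfl, rfl⟩
  have h23 := hsc _ _ _ _ hb₂' hb₃ (by omega) ⟨_, _, _, _, _, rfl, rfl⟩
  have h34 := hsc _ _ _ _ hb₃' hb₄ (by omega) ⟨_, _, _, _, _, rfl, rfl⟩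
  have h45 := hsc _ _ _ _ hb₄' hb₅ (by omega) ⟨_, _, _, _, _, rfl, rfl⟩
  have cover : ∀ k, k ≤ b₃ → k = a ∨ k = a + 1 ∨ k = b₁ ∨ k = b₁ + 1 ∨ k = b₂ ∨ k = b₂ + 1 ∨
      k = b₃ := by
    intro k hk
    have hlt := (hlen b₃).2 ⟨_, hb₃⟩
    obtain ⟨m, hm⟩ := (hlen k).1 (by omega)
    have hm12 : m < 12 := hV.1 m k hm
    interval_cases m <;> simp_all <;> omega
  have hg_a := hg _ _ ha
  have hg_a' := hg _ _ ha'
  have head_eq_three : ∀ S, LegalStack S (g.drop a) → S.head? = some 3 := fun S hS =>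
    hS.of_pop (t := 2) (t' := 2) (by simpa [h₂] using hg_a) (by simpa [h₂] using hg_a')
  have ha0 : a ≠ 0 := by
    rintro rfl
    simpa using head_eq_three [] hL
  have e₁ : b₁ = 0 := by have := cover 0 (by omega); omega
  subst e₁
  have hL₁ : LegalStack [1] (g.drop 2) := hL.of_push (t := 1) (by simpa [h₂] using hg _ _ hb₁)
  have ha1 : a ≠ 1 := by
    rintro rfl
    have := hV.2.2.1 _ _ _ ha hb₁'
    omega
  have ha2 : a ≠ 2 := by
    rintro rfl
    simpa using head_eq_three _ hL₁
  have e₂ : b₂ = 2 := by have := cover 2 (by omega); omega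
  subst e₂
  have hL₂ : LegalStack [2, 1] (g.drop 4) := by
    simpa using hL₁.of_push (t := 1) (v := 2) (by simpa [h₂] using hg _ _ hb₂)
  have ha3 : a ≠ 3 := by
    rintro rfl
    have := hV.2.2.1 _ _ _ ha hb₂'
    omega
  have ha4 : a ≠ 4 := by
    rintro rfl
    simpa using head_eq_three _ hL₂
  have e₃ : b₃ = 4 := by have := cover 4 (by omega); omega
  subst e₃
  have := hL₂.of_pop (t := 1) (t' := 1) (v := 1)
    (by simpa [h₂] using hg _ _ hb₃) (by simpa [h₂] using hg _ _ hb₃')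
  simp at this
end
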